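/- arXiv:1404.5374 — 3 statements merged into one kernel-verified Lean document; each statement's English description precedes it below -/
import Mathlib

section
/- Let G₁ and G₂ be simple nonabelian subgroups of the group Diff^0_+(S^1) of orientation-preserving homeomorphisms of the circle. Assume that G₂ = h G₁ h⁻¹ for some h ∈ Diff^0_+(S^1), and that every element of G₁ commutes with every element of G₂. Then G₁ has a global fixed point: Fix(G₁) ≠ ∅. -/
open scoped Manifold

noncomputable section

/-- The circle, as `ℝ/ℤ`. -/
abbrev Circ := UnitAddCircle

/-- A permutation of the circle is orientation preserving if it admits a strictly
increasing continuous lift `F : ℝ → ℝ` commuting with the integer translations. -/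
def OrientPres (f : Equiv.Perm Circ) : Prop :=
  ∃ F : ℝ → ℝ, StrictMono F ∧ Continuous F ∧ (∀ x, F (x + 1) = F x + 1) ∧
    ∀ x : ℝ, ((F x : ℝ) : Circ) = f (x : Circ)

/-- The group of orientation-preserving homeomorphisms of the circle. -/
def HomeoPlusS1 : Subgroup (Equiv.Perm Circ) where
  carrier := {f | Continuous ⇑f ∧ Continuous ⇑f.symm ∧ OrientPres f}
  one_mem' := ⟨continuous_id, continuous_id, id, strictMono_id, continuous_id,
    fun _ => rfl, fun _ => rfl⟩
  mul_mem' := by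
    rintro a b ⟨ha1, ha2, Fa, hFa1, hFa2, hFa3, hFa4⟩ ⟨hb1, hb2, Fb, hFb1, hFb2, hFb3, hFb4⟩
    refine ⟨ha1.comp hb1, hb2.comp ha2, Fa ∘ Fb, hFa1.comp hFb1, hFa2.comp hFb2, ?_, ?_⟩
    · intro x
      simp [Function.comp, hFb3 x, hFa3 (Fb x)]
    · intro x
      show ((Fa (Fb x) : ℝ) : Circ) = a (b (x : Circ))
      rw [hFa4 (Fb x), hFb4 x]
  inv_mem' := by
    rintro a ⟨h1, h2, F, hF1, hF2, hF3, hF4⟩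
    refine ⟨h2, h1, ?_⟩
    -- the inverse of the lift is a lift of the inverse
    have hFn : ∀ (n : ℤ) (x : ℝ), F (x + n) = F x + n := by
      have hnat : ∀ (k : ℕ) (x : ℝ), F (x + k) = F x + k := by
        intro k
        induction k with
        | zero => simp
        | succ m ih =>
          intro x
          have hx : (x + (m + 1 : ℕ) : ℝ) = (x + m) + 1 := by push_cast; ring
          rw [hx, hF3, ih]
          push_cast; ring
      intro n x
      obtain ⟨k, rfl | rfl⟩ := Int.eq_nat_or_neg n
      · exact_mod_cast hnat k x
      · have hthis := hnat k (x - k)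
        rw [show (x - (k:ℝ) + (k:ℕ) : ℝ) = x by norm_num] at hthis
        push_cast
        rw [show (x + -(k:ℝ) : ℝ) = x - k by ring]
        linarith [hthis]
    have hsurj : Function.Surjective F := by
      intro y
      have h0 : ∀ n : ℤ, F (0 + n) = F 0 + n := fun n => hFn n 0
      obtain ⟨n, hn⟩ := exists_int_gt (y - F 0)
      obtain ⟨m, hm⟩ := exists_int_lt (y - F 0)
      have hle : F (0 + m) ≤ y := by rw [h0 m]; linarith
      have hge : y ≤ F (0 + n) := by rw [h0 n]; linarith
      have hmn : (0 + m : ℝ) ≤ 0 + n := by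
        have : (m : ℝ) < n := by linarith
        linarith
      obtain ⟨x, _, hx⟩ := intermediate_value_Icc hmn hF2.continuousOn ⟨hle, hge⟩
      exact ⟨x, hx⟩
    let e : ℝ ≃o ℝ := StrictMono.orderIsoOfSurjective F hF1 hsurj
    refine ⟨⇑e.symm, e.symm.strictMono, e.symm.continuous, ?_, ?_⟩
    · intro x
      apply hF1.injective
      have : F (e.symm (x + 1)) = x + 1 := e.apply_symm_apply (x + 1)
      rw [this, hF3, show F (e.symm x) = x from e.apply_symm_apply x]
    · intro x
      apply a.injective
      have h5 : a ((e.symm x : ℝ) : Circ) = ((F (e.symm x) : ℝ) : Circ) := (hF4 (e.symm x)).symm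
      rw [show F (e.symm x) = x from e.apply_symm_apply x] at h5
      simp [h5]


open CircleDeg1Lift in
/-- `L` is a lift of the circle map `g`. -/
def IsLft (L : CircleDeg1Liftˣ) (g : ↥HomeoPlusS1) : Prop :=
  ∀ x : ℝ, ((L x : ℝ) : Circ) = (g : Equiv.Perm Circ) (x : Circ)

lemma exists_lft (g : ↥HomeoPlusS1) : ∃ L : CircleDeg1Liftˣ, IsLft L g := by
  obtain ⟨g, h1, h2, F, hF1, hF2, hF3, hF4⟩ := g
  let f : CircleDeg1Lift := ⟨⟨F, hF1.monotone⟩, hF3⟩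
  have hs : Function.Surjective f := (CircleDeg1Lift.continuous_iff_surjective f).1 hF2
  have hu : IsUnit f := CircleDeg1Lift.isUnit_iff_bijective.2 ⟨hF1.injective, hs⟩
  obtain ⟨L, hL⟩ := hu
  refine ⟨L, fun x => ?_⟩
  rw [hL]
  exact hF4 x

lemma IsLft.mul {L M : CircleDeg1Liftˣ} {g k : ↥HomeoPlusS1} (hL : IsLft L g) (hM : IsLft M k) :
    IsLft (L * M) (g * k) := by
  intro x
  have := hL (M x)
  rw [hM x] at this
  simpa using this

lemma IsLft.inv {L : CircleDeg1Liftˣ} {g : ↥HomeoPlusS1} (hL : IsLft L g) :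
    IsLft L⁻¹ g⁻¹ := by
  intro x
  have := hL ((L⁻¹ : CircleDeg1Liftˣ) x)
  rw [CircleDeg1Lift.units_apply_inv_apply] at this
  rw [this]
  simp

lemma IsLft.one : IsLft 1 1 := fun x => by simp

lemma IsLft.pow {L : CircleDeg1Liftˣ} {g : ↥HomeoPlusS1} (hL : IsLft L g) (n : ℕ) :
    IsLft (L ^ n) (g ^ n) := by
  induction n with
  | zero => simpa using IsLft.one
  | succ n ih => rw [pow_succ, pow_succ]; exact ih.mul hL

lemma unit_strictMono (L : CircleDeg1Liftˣ) : StrictMono L := by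
  have := (CircleDeg1Lift.toOrderIso L).strictMono
  simpa using this

lemma unit_continuous (L : CircleDeg1Liftˣ) : Continuous L := by
  have := (CircleDeg1Lift.toOrderIso L).continuous
  simpa using this

lemma coe_eq_iff_int {x y : ℝ} : (x : Circ) = (y : Circ) ↔ ∃ m : ℤ, x = y + m := by
  rw [← sub_eq_zero, ← AddCircle.coe_sub, AddCircle.coe_eq_zero_iff]
  constructor
  · rintro ⟨n, hn⟩
    exact ⟨n, by simp at hn; linarith⟩
  · rintro ⟨n, hn⟩
    exact ⟨n, by simp; linarith⟩

lemma IsLft.eq_of_one {L : CircleDeg1Liftˣ} (hL : IsLft L 1) {x : ℝ} {m : ℤ}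
    (hx : L x = x + m) (y : ℝ) : L y = y + m := by
  have h1 : ((L y : ℝ) : Circ) = (y : Circ) := by simpa using hL y
  obtain ⟨k, hk⟩ := coe_eq_iff_int.1 h1
  set n := ⌊y - x⌋
  have hn1 : (n : ℝ) ≤ y - x := Int.floor_le _
  have hn2 : y - x < n + 1 := Int.lt_floor_add_one _
  have e1 : L (x + n) ≤ L y := (L : CircleDeg1Lift).mono (by linarith)
  have e2 : L y < L (x + (n + 1 : ℤ)) := unit_strictMono L (by push_cast; linarith)
  rw [CircleDeg1Lift.map_add_int, hx] at e1 e2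
  push_cast at e2
  have k1 : (k : ℝ) < m + 1 := by linarith
  have k2 : (m : ℝ) < k + 1 := by linarith
  have : k = m := by
    have k1' : k < m + 1 := by exact_mod_cast k1
    have k2' : m < k + 1 := by exact_mod_cast k2
    omega
  rw [hk, this]

section additivity
open CircleDeg1Lift

lemma trans_add_of_le (U V : CircleDeg1Lift) (h : ∀ x, U (V x) ≤ V (U x)) :
    translationNumber (U * V) = translationNumber U + translationNumber V := by
  have hV : ∀ n : ℕ, ∀ x, U ((V ^ n) x) ≤ (V ^ n) (U x) := by
    intro n
    induction n with
    | zero => intro x; simp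
    | succ n ih =>
      intro x
      rw [pow_succ', mul_apply, mul_apply]
      exact (h _).trans (V.mono (ih x))
  have hU : ∀ n : ℕ, ∀ x, (U ^ n) (V x) ≤ V ((U ^ n) x) := by
    intro n
    induction n with
    | zero => intro x; simp
    | succ n ih =>
      intro x
      rw [pow_succ', mul_apply, mul_apply]
      exact (U.mono (ih x)).trans (h _)
  have up : ∀ n : ℕ, ∀ x, ((U * V) ^ n) x ≤ (V ^ n) ((U ^ n) x) := by
    intro n
    induction n with
    | zero => intro x; simp
    | succ n ih =>
      intro x
      rw [pow_succ', mul_apply, pow_succ' U, mul_apply]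
      refine ((U * V).mono (ih x)).trans ?_
      have := hV (n + 1) ((U ^ n) x)
      rw [pow_succ', mul_apply] at this
      simpa [pow_succ'] using this
  have low : ∀ n : ℕ, ∀ x, (U ^ n) ((V ^ n) x) ≤ ((U * V) ^ n) x := by
    intro n
    induction n with
    | zero => intro x; simp
    | succ n ih =>
      intro x
      rw [pow_succ' (U * V), mul_apply, pow_succ' U, pow_succ' V, mul_apply, mul_apply]
      refine le_trans ?_ ((U * V).mono (ih x))
      exact U.mono (hU n _)
  set a := translationNumber U
  set b := translationNumber V
  set c := translationNumber (U * V)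
  have key : ∀ n : ℕ, |(n : ℝ) * (c - (a + b))| ≤ 4 := by
    intro n
    have d1 := dist_pow_map_zero_mul_translationNumber_le U n
    have d2 := dist_pow_map_zero_mul_translationNumber_le V n
    have d3 := dist_pow_map_zero_mul_translationNumber_le (U * V) n
    have u1 := up n 0
    have l1 := low n 0
    have u2 := map_map_zero_lt (V ^ n) (U ^ n)
    have l2 := lt_map_map_zero (U ^ n) (V ^ n)
    rw [Real.dist_eq, abs_le] at d1 d2 d3
    rw [abs_le]
    constructor <;> nlinarith
  by_contra hne
  have hpos : 0 < |c - (a + b)| := abs_pos.2 (sub_ne_zero.2 hne)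
  obtain ⟨n, hn⟩ := exists_nat_gt (4 / |c - (a + b)|)
  have := key n
  rw [abs_mul, Nat.abs_cast] at this
  rw [div_lt_iff₀ hpos] at hn
  linarith

end additivity

/-- Hölder: a group acting freely on the circle is abelian. -/
lemma holder_circle (G : Subgroup ↥HomeoPlusS1)
    (hfree : ∀ g ∈ G, (∃ z, (g : Equiv.Perm Circ) z = z) → g = 1) :
    ∀ a ∈ G, ∀ b ∈ G, a * b = b * a := by
  have cmp : ∀ u ∈ G, ∀ v ∈ G, ∀ U V : CircleDeg1Liftˣ, IsLft U u → IsLft V v →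
      (∀ x, U (V x) ≤ V (U x)) ∨ (∀ x, V (U x) ≤ U (V x)) := by
    intro u hu v hv U V hU hV
    by_cases hex : ∃ x, U (V x) = V (U x)
    · obtain ⟨x, hx⟩ := hex
      left
      have hD : IsLft ((V * U)⁻¹ * (U * V)) ((v * u)⁻¹ * (u * v)) :=
        (hV.mul hU).inv.mul (hU.mul hV)
      have hDx : ((V * U)⁻¹ * (U * V) : CircleDeg1Liftˣ) x = x := by
        have : ((V * U)⁻¹ : CircleDeg1Liftˣ) ((V * U : CircleDeg1Liftˣ) x) = x :=
          CircleDeg1Lift.units_inv_apply_apply _ _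
        rw [Units.val_mul, CircleDeg1Lift.mul_apply]
        have h2 : (U * V : CircleDeg1Liftˣ) x = (V * U : CircleDeg1Liftˣ) x := by
          simpa using hx
        rw [h2, this]
      have h1 := hfree _ (G.mul_mem (G.inv_mem (G.mul_mem hv hu)) (G.mul_mem hu hv))
        ⟨(x : Circ), by rw [← hD x, hDx]⟩
      rw [h1] at hD
      intro y
      have hy := hD.eq_of_one (x := x) (m := 0) (by simpa using hDx) y
      have hy2 : ((V * U)⁻¹ : CircleDeg1Liftˣ) ((U * V : CircleDeg1Liftˣ) y) = y := by
        rw [Units.val_mul, CircleDeg1Lift.mul_apply] at hy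
        simpa using hy
      have hy3 := congrArg (V * U : CircleDeg1Liftˣ) hy2
      rw [CircleDeg1Lift.units_apply_inv_apply] at hy3
      exact le_of_eq (by simpa using hy3)
    · push Not at hex
      have hc1 : Continuous fun x => U (V x) := (unit_continuous U).comp (unit_continuous V)
      have hc2 : Continuous fun x => V (U x) := (unit_continuous V).comp (unit_continuous U)
      by_contra hcon
      push Not at hcon
      obtain ⟨⟨x, hx⟩, ⟨y, hy⟩⟩ := hcon
      obtain ⟨z, hz⟩ := mem_range_of_exists_le_of_exists_ge (hc1.sub hc2) (c := 0)
        ⟨y, by simp; exact hy.le⟩ ⟨x, by simp; exact hx.le⟩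
      exact hex z (sub_eq_zero.1 hz)
  intro a ha b hb
  obtain ⟨F, hF⟩ := exists_lft a
  obtain ⟨H, hH⟩ := exists_lft b
  set U := F * H * F⁻¹ with hUdef
  set V := H⁻¹ with hVdef
  have hU : IsLft U (a * b * a⁻¹) := (hF.mul hH).mul hF.inv
  have hV : IsLft V b⁻¹ := hH.inv
  have tU : CircleDeg1Lift.translationNumber U = CircleDeg1Lift.translationNumber H := by
    rw [hUdef, Units.val_mul, Units.val_mul]
    exact CircleDeg1Lift.translationNumber_conj_eq F H
  have tV : CircleDeg1Lift.translationNumber V = - CircleDeg1Lift.translationNumber H :=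
    CircleDeg1Lift.translationNumber_units_inv H
  have hfix : ∃ w ∈ G, (∃ x, (w : Equiv.Perm Circ) x = x) ∧ (w = 1 → a * b = b * a) := by
    rcases cmp _ (G.mul_mem (G.mul_mem ha hb) (G.inv_mem ha)) _ (G.inv_mem hb) U V hU hV with h | h
    · have ht := trans_add_of_le (U : CircleDeg1Lift) V h
      rw [tU, tV, add_neg_cancel] at ht
      obtain ⟨x, hx⟩ := (CircleDeg1Lift.translationNumber_eq_int_iff (m := 0)
        ((U * V : CircleDeg1Liftˣ) : CircleDeg1Lift) (unit_continuous (U * V))).1 (by simpa using ht)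
      refine ⟨_, G.mul_mem (G.mul_mem (G.mul_mem ha hb) (G.inv_mem ha)) (G.inv_mem hb),
        ⟨(x : Circ), ?_⟩, fun hw => ?_⟩
      · rw [← (hU.mul hV) x, hx]; simp
      · have := mul_inv_eq_one.1 hw
        exact mul_inv_eq_iff_eq_mul.1 this
    · have ht := trans_add_of_le (V : CircleDeg1Lift) U h
      rw [tU, tV, neg_add_cancel] at ht
      obtain ⟨x, hx⟩ := (CircleDeg1Lift.translationNumber_eq_int_iff (m := 0)
        ((V * U : CircleDeg1Liftˣ) : CircleDeg1Lift) (unit_continuous (V * U))).1 (by simpa using ht)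
      refine ⟨_, G.mul_mem (G.inv_mem hb) (G.mul_mem (G.mul_mem ha hb) (G.inv_mem ha)),
        ⟨(x : Circ), ?_⟩, fun hw => ?_⟩
      · rw [← (hV.mul hU) x, hx]; simp
      · have := inv_mul_eq_one.1 hw
        exact mul_inv_eq_iff_eq_mul.1 this.symm
  obtain ⟨w, hw, hwx, hwa⟩ := hfix
  exact hwa (hfree w hw hwx)

/-- A simple nonabelian group with a finite orbit has a global fixed point. -/
lemma fixed_of_finite (G : Subgroup ↥HomeoPlusS1) (hs : IsSimpleGroup ↥G)
    (hna : ∃ a ∈ G, ∃ b ∈ G, a * b ≠ b * a) (P : Set Circ) (hP : P.Finite) (hne : P.Nonempty)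
    (hinv : ∀ g ∈ G, ∀ z ∈ P, (g : Equiv.Perm Circ) z ∈ P) :
    ∃ z : Circ, ∀ g ∈ G, (g : Equiv.Perm Circ) z = z := by
  let N : Subgroup ↥G :=
    { carrier := {g | ∀ z ∈ P, ((g : ↥HomeoPlusS1) : Equiv.Perm Circ) z = z}
      one_mem' := fun z _ => by simp
      mul_mem' := by
        intro a b ha hb z hz
        have h1 := ha z hz
        have h2 := hb z hz
        simp [h1, h2]
      inv_mem' := by
        intro a ha z hz
        have h1 := ha z hz
        exact (Equiv.Perm.inv_eq_iff_eq).2 h1.symm }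
  have hN : N.Normal := by
    refine ⟨fun n hn g z hz => ?_⟩
    have h1 := hn _ (hinv _ (G.inv_mem g.2) z hz)
    simp only [Subgroup.coe_mul, Subgroup.coe_inv, Equiv.Perm.mul_apply] at h1 ⊢
    rw [h1]; simp
  rcases hN.eq_bot_or_eq_top with h | h
  · exfalso
    have : Finite P := hP
    have hfin : Finite ↥G := by
      refine Finite.of_injective (fun g : ↥G => fun z : P =>
        (⟨((g : ↥HomeoPlusS1) : Equiv.Perm Circ) z, hinv g g.2 z z.2⟩ : P)) ?_
      intro a b hab
      have : b⁻¹ * a ∈ N := by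
        intro z hz
        have := congrArg Subtype.val (congrFun hab ⟨z, hz⟩)
        simp only at this
        simp [this]
      rw [h, Subgroup.mem_bot] at this
      exact (inv_mul_eq_one.1 this).symm
    obtain ⟨a, ha, b, hb, hab⟩ := hna
    refine hab (holder_circle G ?_ a ha b hb)
    rintro g hg ⟨z, hz⟩
    obtain ⟨n, hn, hgn⟩ := (isOfFinOrder_iff_pow_eq_one).1 (isOfFinOrder_of_finite (⟨g, hg⟩ : ↥G))
    have hgn : g ^ n = 1 := congrArg Subtype.val hgn
    obtain ⟨L, hL⟩ := exists_lft g
    obtain ⟨x, rfl⟩ := QuotientAddGroup.mk_surjective z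
    have hx : ((L x : ℝ) : Circ) = (x : Circ) := (hL x).trans hz
    obtain ⟨m, hm⟩ := coe_eq_iff_int.1 hx
    have hLn := hL.pow n
    rw [hgn] at hLn
    have hit := CircleDeg1Lift.iterate_eq_of_map_eq_add_int (L : CircleDeg1Lift) hm n
    have hall := hLn.eq_of_one (x := x) (m := n * m) (by simpa [CircleDeg1Lift.coe_pow] using hit)
    apply Subtype.ext
    ext w
    obtain ⟨y, rfl⟩ := QuotientAddGroup.mk_surjective w
    have hy : (L : CircleDeg1Lift) y = y + m := by
      rw [← CircleDeg1Lift.iterate_pos_eq_iff (L : CircleDeg1Lift) hn]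
      simpa [CircleDeg1Lift.coe_pow] using hall y
    have : ((L y : ℝ) : Circ) = (y : Circ) := coe_eq_iff_int.2 ⟨m, hy⟩
    exact (hL y).symm.trans this
  · obtain ⟨z, hz⟩ := hne
    refine ⟨z, fun g hg => ?_⟩
    have : (⟨g, hg⟩ : ↥G) ∈ N := by rw [h]; trivial
    exact this z hz

/-- Two disjoint closed invariant sets give a finite invariant set. -/
lemma finite_of_disjoint (G : Subgroup ↥HomeoPlusS1) (A B : Set Circ)
    (hA : IsClosed A) (hB : IsClosed B) (hAn : A.Nonempty) (hBn : B.Nonempty)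
    (hAB : A ∩ B = ∅)
    (hAi : ∀ g ∈ G, ∀ z ∈ A, (g : Equiv.Perm Circ) z ∈ A)
    (hBi : ∀ g ∈ G, ∀ z ∈ B, (g : Equiv.Perm Circ) z ∈ B) :
    ∃ P : Set Circ, P.Finite ∧ P.Nonempty ∧ ∀ g ∈ G, ∀ z ∈ P, (g : Equiv.Perm Circ) z ∈ P := by
  let A' : Set ℝ := {x | (x : Circ) ∈ A}
  have hcoe : Continuous (fun x : ℝ => (x : Circ)) := AddCircle.continuous_mk' 1
  have hA'c : IsClosed A' := hA.preimage hcoe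
  let α : ℝ → ℝ := fun x => sSup (A' ∩ Set.Iic x)
  have hne : ∀ x, (A' ∩ Set.Iic x).Nonempty := by
    intro x
    obtain ⟨a, ha⟩ := hAn
    obtain ⟨r, rfl⟩ := QuotientAddGroup.mk_surjective a
    refine ⟨r + ⌊x - r⌋, ?_, ?_⟩
    · have : ((r + ⌊x - r⌋ : ℝ) : Circ) = (r : Circ) := coe_eq_iff_int.2 ⟨_, rfl⟩
      change ((r + ⌊x - r⌋ : ℝ) : Circ) ∈ A
      rw [this]; exact ha
    · have := Int.floor_le (x - r)
      simp only [Set.mem_Iic]; linarith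
  have hbd : ∀ x, BddAbove (A' ∩ Set.Iic x) := fun x => ⟨x, fun y hy => hy.2⟩
  have equiv : ∀ F : CircleDeg1Liftˣ, (∀ y, F y ∈ A' ↔ y ∈ A') → ∀ x, α (F x) = F (α x) := by
    intro F hF x
    have h1 := (CircleDeg1Lift.toOrderIso F).map_csSup' (hne x) (hbd x)
    rw [CircleDeg1Lift.coe_toOrderIso] at h1
    change _ = F (sSup (A' ∩ Set.Iic x))
    rw [h1]
    refine congrArg sSup ?_
    ext y
    constructor
    · rintro ⟨hy1, hy2⟩
      refine ⟨(F⁻¹ : CircleDeg1Liftˣ) y, ⟨?_, ?_⟩, CircleDeg1Lift.units_apply_inv_apply F y⟩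
      · rw [← hF, CircleDeg1Lift.units_apply_inv_apply]; exact hy1
      · rw [Set.mem_Iic, ← (unit_strictMono F).le_iff_le, CircleDeg1Lift.units_apply_inv_apply]
        exact hy2
    · rintro ⟨w, ⟨hw1, hw2⟩, rfl⟩
      exact ⟨(hF w).2 hw1, (F : CircleDeg1Lift).mono hw2⟩
  have hint : ∀ (x : ℝ) (m : ℤ), α (m + x) = m + α x := by
    intro x m
    have := equiv (CircleDeg1Lift.translate (Multiplicative.ofAdd (m : ℝ))) (by
      intro y
      rw [CircleDeg1Lift.translate_apply]
      have : ((m + y : ℝ) : Circ) = (y : Circ) := coe_eq_iff_int.2 ⟨m, add_comm _ _⟩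
      change ((m + y : ℝ) : Circ) ∈ A ↔ _
      rw [this]; rfl) x
    simpa only [CircleDeg1Lift.translate_apply] using this
  have hloc : ∀ x, x ∉ A' → ∀ᶠ y in nhds x, α y = α x := by
    intro x hx
    obtain ⟨ε, hε, hball⟩ := Metric.isOpen_iff.1 hA'c.isOpen_compl x hx
    filter_upwards [Metric.ball_mem_nhds x hε] with y hy
    refine congrArg sSup ?_
    rw [Metric.mem_ball, Real.dist_eq, abs_lt] at hy
    have hout : ∀ w ∈ A', ¬ (x - ε < w ∧ w < x + ε) := by
      rintro w hw ⟨h1, h2⟩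
      refine hball (a := w) ?_ hw
      rw [Metric.mem_ball, Real.dist_eq, abs_lt]
      constructor <;> linarith
    ext w
    constructor
    · rintro ⟨hw1, hw2⟩
      refine ⟨hw1, ?_⟩
      by_contra hc
      simp only [Set.mem_Iic, not_le] at hc hw2
      exact hout w hw1 ⟨by linarith, by linarith⟩
    · rintro ⟨hw1, hw2⟩
      refine ⟨hw1, ?_⟩
      by_contra hc
      simp only [Set.mem_Iic, not_le] at hc hw2
      exact hout w hw1 ⟨by linarith, by linarith⟩
  let K : Set ℝ := {x | (x : Circ) ∈ B} ∩ Set.Icc 0 1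
  have hK : IsCompact K := isCompact_Icc.inter_left (hB.preimage hcoe)
  have : CompactSpace K := isCompact_iff_compactSpace.1 hK
  have hfin : (Set.range (fun b : K => α b)).Finite := by
    apply IsLocallyConstant.range_finite
    rw [IsLocallyConstant.iff_eventually_eq]
    intro b
    have hb : (b : ℝ) ∉ A' := fun h => by
      have : ((b : ℝ) : Circ) ∈ A ∩ B := ⟨h, b.2.1⟩
      rw [hAB] at this; exact this
    exact continuous_subtype_val.continuousAt.eventually (hloc b hb)
  refine ⟨{z | ∃ b : ℝ, (b : Circ) ∈ B ∧ z = (α b : Circ)}, ?_, ?_, ?_⟩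
  · refine (hfin.image (fun x : ℝ => (x : Circ))).subset ?_
    rintro z ⟨b, hb, rfl⟩
    have hf : (⌊b⌋ : ℝ) + Int.fract b = b := Int.floor_add_fract b
    have hfb : ((Int.fract b : ℝ) : Circ) = (b : Circ) :=
      (coe_eq_iff_int.2 ⟨⌊b⌋, by linarith⟩ : (b : Circ) = _).symm
    refine ⟨α (Int.fract b), ⟨⟨Int.fract b, ?_, Int.fract_nonneg b, (Int.fract_lt_one b).le⟩, rfl⟩, ?_⟩
    · change ((Int.fract b : ℝ) : Circ) ∈ B
      rw [hfb]; exact hb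
    · have h2 := hint (Int.fract b) ⌊b⌋
      rw [hf] at h2
      exact (coe_eq_iff_int.2 ⟨⌊b⌋, by linarith⟩ : ((α b : ℝ) : Circ) = _).symm
  · obtain ⟨b, hb⟩ := hBn
    obtain ⟨r, rfl⟩ := QuotientAddGroup.mk_surjective b
    exact ⟨_, r, hb, rfl⟩
  · rintro g hg z ⟨b, hb, rfl⟩
    obtain ⟨L, hL⟩ := exists_lft g
    refine ⟨L b, ?_, ?_⟩
    · rw [hL]; exact hBi g hg _ hb
    · rw [equiv L ?_ b, hL]
      intro y
      change ((L y : ℝ) : Circ) ∈ A ↔ (y : Circ) ∈ A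
      rw [hL]
      refine ⟨fun h => ?_, hAi g hg _⟩
      have := hAi _ (G.inv_mem hg) _ h
      simpa using this


/-- **Proposition.** If `G₁`, `G₂` are simple nonabelian subgroups of the group of
orientation-preserving homeomorphisms of the circle, `G₂` is conjugate to `G₁`, and
every element of `G₁` commutes with every element of `G₂`, then `G₁` has a global
fixed point. -/
theorem commuting_conjugate_simple_subgroups_fixed_point
    (G₁ G₂ : Subgroup ↥HomeoPlusS1)
    (hs1 : IsSimpleGroup ↥G₁) (hs2 : IsSimpleGroup ↥G₂)
    (hna1 : ∃ a ∈ G₁, ∃ b ∈ G₁, a * b ≠ b * a)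
    (hna2 : ∃ a ∈ G₂, ∃ b ∈ G₂, a * b ≠ b * a)
    (hconj : ∃ h : ↥HomeoPlusS1, Subgroup.map (MulAut.conj h).toMonoidHom G₁ = G₂)
    (hcomm : ∀ a ∈ G₁, ∀ b ∈ G₂, a * b = b * a) :
    ∃ z : Circ, ∀ g ∈ G₁, ((g : Equiv.Perm Circ)) z = z := by
  by_contra hno
  obtain ⟨h, hh⟩ := hconj
  have hno2 : ¬ ∃ z : Circ, ∀ g ∈ G₂, (g : Equiv.Perm Circ) z = z := by
    rintro ⟨z, hz⟩
    refine hno ⟨((h⁻¹ : ↥HomeoPlusS1) : Equiv.Perm Circ) z, fun g hg => ?_⟩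
    have hm : h * g * h⁻¹ ∈ G₂ := by
      rw [← hh]; exact ⟨g, hg, rfl⟩
    have := hz _ hm
    simp only [Subgroup.coe_mul, Subgroup.coe_inv, Equiv.Perm.mul_apply] at this ⊢
    rw [Equiv.Perm.eq_inv_iff_eq]
    exact this
  have hmeet : ∀ A B : Set Circ, IsClosed A → IsClosed B → A.Nonempty → B.Nonempty →
      (∀ g ∈ G₂, ∀ z ∈ A, (g : Equiv.Perm Circ) z ∈ A) →
      (∀ g ∈ G₂, ∀ z ∈ B, (g : Equiv.Perm Circ) z ∈ B) → (A ∩ B).Nonempty := by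
    intro A B hA hB hAn hBn hAi hBi
    by_contra hc
    rw [Set.not_nonempty_iff_eq_empty] at hc
    obtain ⟨P, hP1, hP2, hP3⟩ := finite_of_disjoint G₂ A B hA hB hAn hBn hc hAi hBi
    exact hno2 (fixed_of_finite G₂ hs2 hna2 P hP1 hP2 hP3)
  let Fx : ↥G₁ → Set Circ := fun g => {z | ((g : ↥HomeoPlusS1) : Equiv.Perm Circ) z = z}
  have hFc : ∀ g, IsClosed (Fx g) := fun g => isClosed_eq g.1.2.1 continuous_id
  have hFi : ∀ g : ↥G₁, ∀ k ∈ G₂, ∀ z ∈ Fx g, (k : Equiv.Perm Circ) z ∈ Fx g := by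
    intro g k hk z hz
    have hc := hcomm g g.2 k hk
    have hc2 := congrArg (fun u : ↥HomeoPlusS1 => (u : Equiv.Perm Circ) z) hc
    simp only [Subgroup.coe_mul, Equiv.Perm.mul_apply] at hc2
    change ((g : ↥HomeoPlusS1) : Equiv.Perm Circ) z = z at hz
    change ((g : ↥HomeoPlusS1) : Equiv.Perm Circ) ((k : Equiv.Perm Circ) z) = _
    rw [hc2, hz]
  let N : Subgroup ↥G₁ :=
    { carrier := {g | (Fx g).Nonempty}
      one_mem' := ⟨0, by simp [Fx]⟩
      mul_mem' := by
        intro a b ha hb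
        obtain ⟨z, hz1, hz2⟩ := hmeet _ _ (hFc a) (hFc b) ha hb (hFi a) (hFi b)
        refine ⟨z, ?_⟩
        simp only [Fx, Set.mem_ofPred_eq] at hz1 hz2
        simp [Fx, hz1, hz2]
      inv_mem' := by
        rintro a ⟨z, hz⟩
        refine ⟨z, ?_⟩
        simp only [Fx, Set.mem_ofPred_eq] at hz
        exact (Equiv.Perm.inv_eq_iff_eq).2 hz.symm }
  have hN : N.Normal := by
    refine ⟨?_⟩
    rintro n ⟨z, hz⟩ g
    refine ⟨((g : ↥HomeoPlusS1) : Equiv.Perm Circ) z, ?_⟩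
    simp only [Fx, Set.mem_ofPred_eq] at hz
    simp [Fx, hz]
  have htop : N = ⊤ := by
    rcases hN.eq_bot_or_eq_top with hb | ht
    · exfalso
      obtain ⟨a, ha, b, hb', hab⟩ := hna1
      refine hab (holder_circle G₁ ?_ a ha b hb')
      rintro g hg ⟨z, hz⟩
      have : (⟨g, hg⟩ : ↥G₁) ∈ N := ⟨z, hz⟩
      rw [hb, Subgroup.mem_bot] at this
      exact congrArg Subtype.val this
    · exact ht
  have hall : ∀ g, (Fx g).Nonempty := fun g => by
    have : g ∈ N := by rw [htop]; trivial
    exact this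
  have hfinset : ∀ u : Finset ↥G₁, (⋂ g ∈ u, Fx g).Nonempty := by
    classical
    intro u
    induction u using Finset.induction_on with
    | empty => simp
    | insert g u _ ih =>
      rw [Finset.set_biInter_insert]
      refine hmeet _ _ (hFc g) (isClosed_biInter fun i _ => hFc i) (hall g) ih (hFi g) ?_
      intro k hk z hz
      simp only [Set.mem_iInter] at hz ⊢
      exact fun i hi => hFi i k hk z (hz i hi)
  obtain ⟨z, -, hz⟩ := isCompact_univ.inter_iInter_nonempty Fx hFc
    (fun u => by simpa using hfinset u)
  refine hno ⟨z, fun g hg => ?_⟩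
  exact Set.mem_iInter.1 hz ⟨g, hg⟩

end
end

section
/- Let Γ be a nontrivial simple subgroup of the group Homeo_+(ℝ) of orientation-preserving homeomorphisms of ℝ, with no global fixed point, and suppose some compact interval I ⊂ ℝ intersects every Γ-orbit. Then there exists a nonempty closed Γ-invariant subset X ⊆ ℝ which is contained in every nonempty closed Γ-invariant subset of ℝ; in particular Γ has a unique minimal set. -/
open scoped Manifold

noncomputable section

/-- The group of orientation-preserving homeomorphisms of the real line:
continuous strictly increasing bijections with continuous inverse. -/
def HomeoPlusR : Subgroup (Equiv.Perm ℝ) where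
  carrier := {f | Continuous ⇑f ∧ Continuous ⇑f.symm ∧ StrictMono ⇑f}
  one_mem' := ⟨continuous_id, continuous_id, strictMono_id⟩
  mul_mem' := by
    rintro a b ⟨ha1, ha2, ha3⟩ ⟨hb1, hb2, hb3⟩
    exact ⟨ha1.comp hb1, hb2.comp ha2, ha3.comp hb3⟩
  inv_mem' := by
    rintro a ⟨h1, h2, h3⟩
    refine ⟨h2, h1, ?_⟩
    intro x y hxy
    have : a (a.symm x) < a (a.symm y) := by simpa using hxy
    exact h3.lt_iff_lt.mp this

/-- A set `X ⊆ ℝ` is invariant under the subgroup `Γ` of `Homeo₊(ℝ)`. -/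
def InvSet (Γ : Subgroup ↥HomeoPlusR) (X : Set ℝ) : Prop :=
  ∀ g ∈ Γ, ((g : Equiv.Perm ℝ)) '' X = X

/-- A minimal set of `Γ`: a nonempty closed invariant set all of whose nonempty
closed invariant subsets coincide with it. -/
def IsMinimalSet (Γ : Subgroup ↥HomeoPlusR) (X : Set ℝ) : Prop :=
  X.Nonempty ∧ IsClosed X ∧ InvSet Γ X ∧
    ∀ Y ⊆ X, Y.Nonempty → IsClosed Y → InvSet Γ Y → Y = X

section Aux

variable {G : Type*} [Group G] [MulAction G ℝ]

/-- invariance, closedness and nonemptiness for a group action on the line -/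
def GoodSet (G : Type*) [Group G] [MulAction G ℝ] (X : Set ℝ) : Prop :=
  X.Nonempty ∧ IsClosed X ∧ ∀ g : G, ∀ x ∈ X, g • x ∈ X

theorem exists_minimal_good (a b : ℝ) (hcross : ∀ x : ℝ, ∃ g : G, g • x ∈ Set.Icc a b) :
    ∃ M : Set ℝ, GoodSet G M ∧ ∀ Y ⊆ M, GoodSet G Y → Y = M := by
  obtain ⟨M, hM⟩ := zorn_superset {X | GoodSet G X} (by
    intro c hc hchain
    rcases c.eq_empty_or_nonempty with rfl | hne
    · exact ⟨Set.univ, ⟨⟨0, trivial⟩, isClosed_univ, fun _ _ _ => trivial⟩, by simp⟩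
    refine ⟨⋂₀ c, ⟨?_, isClosed_sInter fun s hs => (hc hs).2.1, ?_⟩,
      fun s hs => Set.sInter_subset_of_mem hs⟩
    · have key : (⋂ s : c, (s : Set ℝ) ∩ Set.Icc a b).Nonempty := by
        have : Nonempty c := hne.to_subtype
        refine IsCompact.nonempty_iInter_of_directed_nonempty_isCompact_isClosed
          (fun s : c => (s : Set ℝ) ∩ Set.Icc a b) ?_ ?_ ?_ ?_
        · intro s t
          rcases hchain.total s.2 t.2 with h | h
          · exact ⟨s, subset_rfl, Set.inter_subset_inter_left _ h⟩
          · exact ⟨t, Set.inter_subset_inter_left _ h, subset_rfl⟩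
        · rintro ⟨s, hs⟩
          obtain ⟨x, hx⟩ := (hc hs).1
          obtain ⟨g, hg⟩ := hcross x
          exact ⟨g • x, (hc hs).2.2 g x hx, hg⟩
        · rintro ⟨s, hs⟩
          exact isCompact_Icc.inter_left (hc hs).2.1
        · rintro ⟨s, hs⟩
          exact (hc hs).2.1.inter isClosed_Icc
      obtain ⟨x, hx⟩ := key
      rw [Set.mem_iInter] at hx
      exact ⟨x, fun s hs => (hx ⟨s, hs⟩).1⟩
    · intro g x hx s hs
      exact (hc hs).2.2 g x (hx s hs))
  refine ⟨M, hM.prop, fun Y hY hg => subset_antisymm hY (hM.le_of_le hg hY)⟩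

theorem closure_orbit_eq (hcont : ∀ g : G, Continuous fun x : ℝ => g • x)
    {M : Set ℝ} (hM : GoodSet G M) (hmin : ∀ Y ⊆ M, GoodSet G Y → Y = M)
    {x : ℝ} (hx : x ∈ M) : closure (MulAction.orbit G x) = M := by
  apply hmin
  · apply closure_minimal _ hM.2.1
    rintro _ ⟨g, rfl⟩
    exact hM.2.2 g x hx
  · refine ⟨⟨x, subset_closure (MulAction.mem_orbit_self x)⟩, isClosed_closure, ?_⟩
    intro g y hy
    refine map_mem_closure (hcont g) hy ?_
    intro z hz
    exact (MulAction.mem_orbit_smul g z |> fun _ => by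
      obtain ⟨k, rfl⟩ := hz
      exact ⟨g * k, by simp [mul_smul]⟩)

theorem exists_orbit_near (hcont : ∀ g : G, Continuous fun x : ℝ => g • x)
    {M : Set ℝ} (hM : GoodSet G M) (hmin : ∀ Y ⊆ M, GoodSet G Y → Y = M)
    {x y : ℝ} (hx : x ∈ M) (hy : y ∈ M) {U : Set ℝ} (hU : IsOpen U) (hyU : y ∈ U) :
    ∃ g : G, g • x ∈ U := by
  have : y ∈ closure (MulAction.orbit G x) := by rwa [closure_orbit_eq hcont hM hmin hx]
  obtain ⟨z, hz, ⟨g, rfl⟩⟩ := mem_closure_iff.1 this U hU hyU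
  exact ⟨g, hz⟩

theorem good_unbounded (hmono : ∀ g : G, StrictMono fun x : ℝ => g • x)
    (hnofix : ¬ ∃ x : ℝ, ∀ g : G, g • x = x) {M : Set ℝ} (hM : GoodSet G M) :
    (∀ x, ∃ y ∈ M, x < y) ∧ (∀ x, ∃ y ∈ M, y < x) := by
  constructor
  · by_contra! h
    obtain ⟨x, hx⟩ := h
    have hL := (hM.2.1.isGreatest_csSup hM.1 ⟨x, hx⟩)
    refine hnofix ⟨sSup M, fun g => le_antisymm (hL.2 (hM.2.2 g _ hL.1)) ?_⟩
    have := (hmono g).monotone (hL.2 (hM.2.2 g⁻¹ _ hL.1))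
    simpa using this
  · by_contra! h
    obtain ⟨x, hx⟩ := h
    have hL := (hM.2.1.isLeast_csInf hM.1 ⟨x, hx⟩)
    refine hnofix ⟨sInf M, fun g => le_antisymm ?_ (hL.2 (hM.2.2 g _ hL.1))⟩
    have := (hmono g).monotone (hL.2 (hM.2.2 g⁻¹ _ hL.1))
    simpa using this

theorem perfect_case (hcont : ∀ g : G, Continuous fun x : ℝ => g • x)
    (hmono : ∀ g : G, StrictMono fun x : ℝ => g • x)
    (hnofix : ¬ ∃ x : ℝ, ∀ g : G, g • x = x)
    {M : Set ℝ} (hM : GoodSet G M) (hmin : ∀ Y ⊆ M, GoodSet G Y → Y = M)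
    (hperf : ∀ x ∈ M, ∀ U : Set ℝ, IsOpen U → x ∈ U → ∃ y ∈ M, y ∈ U ∧ y ≠ x)
    {Y : Set ℝ} (hY : GoodSet G Y) : M ⊆ Y := by
  by_cases hne : (M ∩ Y).Nonempty
  · have := hmin (M ∩ Y) Set.inter_subset_left ⟨hne, hM.2.1.inter hY.2.1,
      fun g x hx => ⟨hM.2.2 g x hx.1, hY.2.2 g x hx.2⟩⟩
    exact Set.inter_eq_left.1 this
  exfalso
  obtain ⟨y, hy⟩ := hY.1
  have hyM : y ∉ M := fun h => hne ⟨y, h, hy⟩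
  obtain ⟨hub, hlb⟩ := good_unbounded hmono hnofix hM
  obtain ⟨z, hz, hzy⟩ := hlb y
  have hu : IsGreatest (M ∩ Set.Iic y) (sSup (M ∩ Set.Iic y)) :=
    (hM.2.1.inter isClosed_Iic).isGreatest_csSup ⟨z, hz, hzy.le⟩ ⟨y, fun _ h => h.2⟩
  generalize sSup (M ∩ Set.Iic y) = u at hu
  have huM := hu.1.1
  have huy : u < y := lt_of_le_of_ne hu.1.2 (fun h => hyM (h ▸ huM))
  have huY : u ∉ Y := fun h => hne ⟨u, huM, h⟩
  obtain ⟨c, d, hucd, hcd⟩ := mem_nhds_iff_exists_Ioo_subset.1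
    (hY.2.1.isOpen_compl.mem_nhds huY)
  -- two orbit points in the interval give a contradiction
  have key : ∀ g k : G, g • u < k • u → g • u ∈ Set.Ioo c d → k • u ∈ Set.Ioo c d → False := by
    intro g k hlt hg hk
    have h1 : g • u < g • y := hmono g huy
    have h2 : g • y < k • u := by
      by_contra! hcon
      have h3 : g⁻¹ • k • u ≤ y := by
        have := (hmono g⁻¹).monotone hcon
        simpa using this
      have h4 := hu.2 ⟨hM.2.2 g⁻¹ _ (hM.2.2 k _ huM), h3⟩
      have h5 := (hmono g).monotone h4
      simp only [smul_inv_smul] at h5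
      exact absurd hlt (not_lt.2 h5)
    exact hcd ⟨hg.1.trans h1, h2.trans hk.2⟩ (hY.2.2 g y hy)
  obtain ⟨w, hwM, hw, hwu⟩ := hperf u huM _ isOpen_Ioo hucd
  obtain ⟨g, hg⟩ := exists_orbit_near hcont hM hmin huM hwM
    (isOpen_Ioo.inter (isOpen_compl_singleton (x := u))) ⟨hw, hwu⟩
  rcases lt_or_gt_of_ne hg.2 with h | h
  · exact key g 1 (by simpa using h) hg.1 (by simpa using hucd)
  · exact key 1 g (by simpa using h) (by simpa using hucd) hg.1

theorem discrete_case [IsSimpleGroup G] (hcont : ∀ g : G, Continuous fun x : ℝ => g • x)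
    (hmono : ∀ g : G, StrictMono fun x : ℝ => g • x)
    (hnofix : ¬ ∃ x : ℝ, ∀ g : G, g • x = x)
    {M : Set ℝ} (hM : GoodSet G M) (hmin : ∀ Y ⊆ M, GoodSet G Y → Y = M)
    {m : ℝ} (hm : m ∈ M) {U : Set ℝ} (hU : IsOpen U) (hmU : m ∈ U)
    (hiso : ∀ y ∈ M, y ∈ U → y = m) : False := by
  obtain ⟨hub, hlb⟩ := good_unbounded hmono hnofix hM
  have horb : ∀ y ∈ M, ∃ g : G, y = g • m := by
    intro y hy
    obtain ⟨g, hg⟩ := exists_orbit_near hcont hM hmin hy hm hU hmU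
    exact ⟨g⁻¹, by rw [← hiso _ (hM.2.2 g y hy) hg, inv_smul_smul]⟩
  -- the successor of `m`
  obtain ⟨h, hh⟩ : ∃ h : G, IsLeast (M ∩ Set.Ioi m) (h • m) := by
    obtain ⟨c, d, hcd, hsub⟩ := mem_nhds_iff_exists_Ioo_subset.1 (hU.mem_nhds hmU)
    have hE : M ∩ Set.Ioi m = M ∩ Set.Ici d := by
      ext x
      constructor
      · rintro ⟨h1, h2⟩
        refine ⟨h1, ?_⟩
        by_contra h3
        have := hiso x h1 (hsub ⟨hcd.1.trans h2, not_le.1 h3⟩)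
        exact absurd h2 (by simp [this])
      · rintro ⟨h1, h2⟩
        exact ⟨h1, lt_of_lt_of_le hcd.2 h2⟩
    obtain ⟨z, hz, hzd⟩ := hub d
    have hL : IsLeast (M ∩ Set.Ici d) _ := (hM.2.1.inter isClosed_Ici).isLeast_csInf
      ⟨z, hz, hzd.le⟩ ⟨d, fun _ h => h.2⟩
    rw [← hE] at hL
    obtain ⟨h, hh⟩ := horb _ hL.1.1
    exact ⟨h, hh ▸ hL⟩
  have hmh : m < h • m := hh.1.2
  have hle : ∀ g k : G, g • m < k • m → g • h • m ≤ k • m := by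
    intro g k hlt
    have h1 : m < g⁻¹ • k • m := by
      have := hmono g⁻¹ hlt
      simpa using this
    have h2 := hh.2 ⟨hM.2.2 g⁻¹ _ (hM.2.2 k _ hm), h1⟩
    have h3 := (hmono g).monotone h2
    simpa using h3
  let φ : ℤ → ℝ := fun n => h ^ n • m
  have hφs : ∀ n : ℤ, φ (n + 1) = h ^ n • h • m := by
    intro n
    simp only [φ, zpow_add_one, mul_smul]
  have hφmono : StrictMono φ := by
    refine strictMono_int_of_lt_succ fun n => ?_
    rw [hφs]
    exact hmono (h ^ n) hmh
  have hφM : ∀ n, φ n ∈ M := fun n => hM.2.2 _ _ hm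
  have hφub : ∀ x, ∃ n, x < φ n := by
    by_contra! hcon
    obtain ⟨x, hx⟩ := hcon
    have hlub : IsLUB (Set.range φ) (sSup (Set.range φ)) :=
      isLUB_csSup ⟨_, 0, rfl⟩ ⟨x, by rintro _ ⟨n, rfl⟩; exact hx n⟩
    have hLM : sSup (Set.range φ) ∈ M := by
      refine hM.2.1.closure_subset_iff.2 ?_ (hlub.mem_closure ⟨_, 0, rfl⟩)
      rintro _ ⟨n, rfl⟩; exact hφM n
    obtain ⟨g, hg⟩ := horb _ hLM
    rw [hg] at hlub
    have hlt : g • h⁻¹ • m < g • m := by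
      apply hmono g
      have := hmono h⁻¹ hmh
      simpa using this
    obtain ⟨_, ⟨n, rfl⟩, h1, h2⟩ := hlub.exists_between hlt
    have h3 : g • m ≤ φ n := by
      have := hle (g * h⁻¹) (h ^ n) (by simpa [mul_smul] using h1)
      simpa [mul_smul] using this
    have h4 : φ (n + 1) ≤ g • m := hlub.1 ⟨_, rfl⟩
    have h5 := hφmono (lt_add_one n)
    linarith
  have hφlb : ∀ x, ∃ n, φ n < x := by
    by_contra! hcon
    obtain ⟨x, hx⟩ := hcon
    have hglb : IsGLB (Set.range φ) (sInf (Set.range φ)) :=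
      isGLB_csInf ⟨_, 0, rfl⟩ ⟨x, by rintro _ ⟨n, rfl⟩; exact hx n⟩
    have hLM : sInf (Set.range φ) ∈ M := by
      refine hM.2.1.closure_subset_iff.2 ?_ (hglb.mem_closure ⟨_, 0, rfl⟩)
      rintro _ ⟨n, rfl⟩; exact hφM n
    obtain ⟨g, hg⟩ := horb _ hLM
    rw [hg] at hglb
    have hlt : g • m < g • h • m := hmono g hmh
    obtain ⟨_, ⟨n, rfl⟩, h1, h2⟩ := hglb.exists_between hlt
    have h4 : g • m ≤ φ (n - 1) := hglb.1 ⟨_, rfl⟩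
    have h5 := hφmono (sub_one_lt n)
    have h3 : g • h • m ≤ φ n := hle g (h ^ n) (lt_of_le_of_lt h4 h5)
    linarith
  have hfloor : ∀ g : G, ∃ n : ℤ, g • m = φ n := by
    intro g
    obtain ⟨n, hn, hn'⟩ := Int.exists_greatest_of_bdd (P := fun n => φ n ≤ g • m)
      (by
        obtain ⟨k, hk⟩ := hφub (g • m)
        exact ⟨k, fun z hz => (hφmono.lt_iff_lt.1 (lt_of_le_of_lt hz hk)).le⟩)
      (by
        obtain ⟨k, hk⟩ := hφlb (g • m)
        exact ⟨k, hk.le⟩)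
    refine ⟨n, le_antisymm ?_ hn⟩
    by_contra! hlt
    have h1 := hle (h ^ n) g hlt
    rw [← hφs] at h1
    have := hn' _ h1
    omega
  -- an element fixing `m` fixes `M`
  have hfix1 : ∀ k : G, k • m = m → k • h • m = h • m := by
    intro k hk
    apply le_antisymm
    · have := hle k h (by rw [hk]; exact hmh)
      exact this
    · have := hle 1 (k * h) (by
        rw [one_smul, mul_smul]
        calc m = k • m := hk.symm
          _ < k • h • m := hmono k hmh)
      simpa [mul_smul] using this
  have hfix2 : ∀ k : G, k • m = m → k • h⁻¹ • m = h⁻¹ • m := by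
    intro k hk
    have hlt : h⁻¹ • m < m := by
      have := hmono h⁻¹ hmh
      simpa using this
    have hlt' : k • h⁻¹ • m < m := by
      calc k • h⁻¹ • m < k • m := hmono k hlt
        _ = m := hk
    apply le_antisymm
    · by_contra! hcon
      have := hle h⁻¹ (k * h⁻¹) (by simpa [mul_smul] using hcon)
      rw [inv_smul_smul, mul_smul] at this
      linarith
    · by_contra! hcon
      have := hle (k * h⁻¹) h⁻¹ (by simpa [mul_smul] using hcon)
      rw [mul_smul, inv_smul_smul, hk] at this
      linarith
  have hfixn : ∀ k : G, k • m = m → ∀ n : ℤ, k • φ n = φ n := by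
    intro k hk n
    induction n using Int.induction_on with
    | zero => simpa [φ] using hk
    | succ n ih =>
      have h0 : (h ^ (-(n : ℤ)) * k * h ^ (n : ℤ)) • m = m := by
        have : k • h ^ (n : ℤ) • m = h ^ (n : ℤ) • m := ih
        rw [mul_smul, mul_smul, this, zpow_neg, inv_smul_smul]
      have h1 := hfix1 _ h0
      rw [hφs]
      rw [mul_smul, mul_smul, zpow_neg, inv_smul_eq_iff] at h1
      exact h1
    | pred n ih =>
      have h0 : (h ^ (n : ℤ) * k * h ^ (-(n : ℤ))) • m = m := by
        have : k • h ^ (-(n : ℤ)) • m = h ^ (-(n : ℤ)) • m := ih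
        rw [mul_smul, mul_smul, this, zpow_neg, smul_inv_smul]
      have h1 := hfix2 _ h0
      have h2 : φ (-(n : ℤ) - 1) = h ^ (-(n : ℤ)) • h⁻¹ • m := by
        simp only [φ, zpow_sub_one, mul_smul]
      rw [h2]
      rw [mul_smul, mul_smul] at h1
      have h3 := congrArg (fun x => (h ^ (n : ℤ))⁻¹ • x) h1
      simp only [inv_smul_smul] at h3
      rw [h3, zpow_neg]
  -- the kernel of the action on `M`
  have hker : ∀ k : G, k • m = m → k = 1 := by
    let K : Subgroup G :=
      { carrier := {k | ∀ x ∈ M, k • x = x}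
        one_mem' := fun x _ => one_smul _ x
        mul_mem' := by
          intro p q hp hq x hx
          rw [mul_smul, hq x hx, hp x hx]
        inv_mem' := by
          intro p hp x hx
          rw [inv_smul_eq_iff, hp x hx] }
    have hK : K.Normal := ⟨by
      intro k hk g x hx
      rw [mul_smul, mul_smul, hk _ (hM.2.2 g⁻¹ x hx), smul_inv_smul]⟩
    rcases hK.eq_bot_or_eq_top with hb | ht
    · intro k hk
      have : k ∈ K := by
        intro x hx
        obtain ⟨g, rfl⟩ := horb x hx
        obtain ⟨n, hn⟩ := hfloor g
        rw [hn]
        exact hfixn k hk n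
      rw [hb] at this
      exact Subgroup.mem_bot.1 this
    · have : h ∈ K := by rw [ht]; trivial
      exact absurd (this m hm) hmh.ne'
  have hcyc : ∀ g : G, ∃ n : ℤ, g = h ^ n := by
    intro g
    obtain ⟨n, hn⟩ := hfloor g
    refine ⟨n, ?_⟩
    have : (h ^ n)⁻¹ * g = 1 := hker _ (by rw [mul_smul, hn, inv_smul_smul])
    exact (inv_mul_eq_one.1 this).symm
  have hN : (Subgroup.zpowers (h ^ (2 : ℤ))).Normal := ⟨by
    intro k hk g
    obtain ⟨i, rfl⟩ := hcyc g
    obtain ⟨j, rfl⟩ := hcyc k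
    rwa [← zpow_add, ← zpow_neg, ← zpow_add, add_comm i j, add_neg_cancel_right]⟩
  rcases hN.eq_bot_or_eq_top with hb | ht
  · rw [Subgroup.zpowers_eq_bot] at hb
    have h1 : φ 0 < φ 2 := hφmono (by norm_num)
    simp only [φ, hb, zpow_zero] at h1
    exact lt_irrefl _ h1
  · have : h ∈ Subgroup.zpowers (h ^ (2 : ℤ)) := by rw [ht]; trivial
    obtain ⟨k, hk⟩ := Subgroup.mem_zpowers_iff.1 this
    rw [← zpow_mul] at hk
    have h1 : φ (2 * k) = φ 1 := by simp only [φ, hk, zpow_one]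
    have := hφmono.injective h1
    omega

end Aux

/-- A nontrivial simple subgroup of `Homeo₊(ℝ)` with no global fixed point and with
a compact cross section has a smallest nonempty closed invariant set; in particular
it has a unique minimal set. -/
theorem smallest_invariant_set
    (Γ : Subgroup ↥HomeoPlusR) (hsimple : IsSimpleGroup ↥Γ)
    (hnofix : ¬ ∃ x : ℝ, ∀ g ∈ Γ, ((g : Equiv.Perm ℝ)) x = x)
    (a b : ℝ)
    (hcross : ∀ x : ℝ, ∃ g ∈ Γ, ((g : Equiv.Perm ℝ)) x ∈ Set.Icc a b) :
    (∃ X : Set ℝ, X.Nonempty ∧ IsClosed X ∧ InvSet Γ X ∧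
      ∀ Y : Set ℝ, Y.Nonempty → IsClosed Y → InvSet Γ Y → X ⊆ Y) ∧
    (∃! X : Set ℝ, IsMinimalSet Γ X) := by
  have hmono : ∀ g : Γ, StrictMono fun x : ℝ => g • x := fun g => g.1.2.2.2
  have hcont : ∀ g : Γ, Continuous fun x : ℝ => g • x := fun g => g.1.2.1
  have hnofix' : ¬ ∃ x : ℝ, ∀ g : Γ, g • x = x := by
    rintro ⟨x, hx⟩
    exact hnofix ⟨x, fun g hg => hx ⟨g, hg⟩⟩
  have hgood : ∀ X : Set ℝ, GoodSet Γ X ↔ X.Nonempty ∧ IsClosed X ∧ InvSet Γ X := by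
    intro X
    refine and_congr_right fun _ => and_congr_right fun _ => ⟨fun h g hg => ?_, fun h g x hx => ?_⟩
    · ext y
      constructor
      · rintro ⟨x, hx, rfl⟩
        exact h ⟨g, hg⟩ x hx
      · intro hy
        exact ⟨(⟨g, hg⟩ : Γ)⁻¹ • y, h _ y hy, smul_inv_smul (⟨g, hg⟩ : Γ) y⟩
    · have := h g.1 g.2
      rw [← this]
      exact ⟨x, hx, rfl⟩
  obtain ⟨M, hM, hmin⟩ := exists_minimal_good (G := Γ) a b (by
    intro x
    obtain ⟨g, hg, h⟩ := hcross x
    exact ⟨⟨g, hg⟩, h⟩)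
  have hsub : ∀ Y, GoodSet Γ Y → M ⊆ Y := by
    intro Y hY
    refine perfect_case hcont hmono hnofix' hM hmin ?_ hY
    by_contra! hcon
    obtain ⟨m, hm, U, hU, hmU, hiso⟩ := hcon
    exact discrete_case hcont hmono hnofix' hM hmin hm hU hmU hiso
  have hM' := (hgood M).1 hM
  refine ⟨⟨M, hM'.1, hM'.2.1, hM'.2.2, fun Y h1 h2 h3 => hsub Y ((hgood Y).2 ⟨h1, h2, h3⟩)⟩,
    M, ⟨hM'.1, hM'.2.1, hM'.2.2, fun Y hY h1 h2 h3 => hmin Y hY ((hgood Y).2 ⟨h1, h2, h3⟩)⟩, ?_⟩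
  rintro Z ⟨h1, h2, h3, h4⟩
  exact (h4 M (hsub Z ((hgood Z).2 ⟨h1, h2, h3⟩)) hM'.1 hM'.2.1 hM'.2.2).symm

end
end

section
/- Let Γ be a subgroup of the group Homeo_+(ℝ) of orientation-preserving homeomorphisms of ℝ, and let X ⊆ ℝ be a nonempty closed Γ-invariant set without isolated points such that every Γ-orbit contained in X is dense in X. Then for every x ∈ ℝ the closure of the Γ-orbit of x contains X; consequently X is contained in every nonempty closed Γ-invariant subset of ℝ. -/
open scoped Manifold

noncomputable section

/-- The orbit of a point under a subgroup of `Homeo₊(ℝ)`. -/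
def orbitSet (Γ : Subgroup ↥HomeoPlusR) (x : ℝ) : Set ℝ :=
  {y | ∃ g ∈ Γ, ((g : Equiv.Perm ℝ)) x = y}

/-- If `X` is a nonempty closed invariant set without isolated points in which
every orbit contained in `X` is dense, then every orbit closure contains `X`;
consequently `X` is contained in every nonempty closed invariant set. -/
theorem orbit_closures_contain_X
    (Γ : Subgroup ↥HomeoPlusR) (X : Set ℝ)
    (hne : X.Nonempty) (hcl : IsClosed X) (hinv : InvSet Γ X)
    (hperfect : ∀ x ∈ X, x ∈ closure (X \ {x}))
    (hdense : ∀ x ∈ X, X ⊆ closure (orbitSet Γ x)) :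
    (∀ x : ℝ, X ⊆ closure (orbitSet Γ x)) ∧
    (∀ Y : Set ℝ, Y.Nonempty → IsClosed Y → InvSet Γ Y → X ⊆ Y) := by
  have hinvX : ∀ g ∈ Γ, ∀ y ∈ X, (g : Equiv.Perm ℝ) y ∈ X := by
    intro g hg y hy
    rw [← hinv g hg]
    exact ⟨y, hy, rfl⟩
  have hcancel : ∀ (g : ↥HomeoPlusR) (y : ℝ),
      (g : Equiv.Perm ℝ) (((g⁻¹ : ↥HomeoPlusR) : Equiv.Perm ℝ) y) = y := by
    intro g y
    simp
  have hmono : ∀ g : ↥HomeoPlusR, StrictMono (g : Equiv.Perm ℝ) := fun g => g.2.2.2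
  -- `X` is unbounded below
  have hbdd : ¬ BddBelow X := by
    intro hb
    have hm : sInf X ∈ X := hcl.csInf_mem hne hb
    have hfix : ∀ g ∈ Γ, (g : Equiv.Perm ℝ) (sInf X) = sInf X := by
      intro g hg
      apply le_antisymm
      · have h1 : sInf X ≤ ((g⁻¹ : ↥HomeoPlusR) : Equiv.Perm ℝ) (sInf X) :=
          csInf_le hb (hinvX _ (Γ.inv_mem hg) _ hm)
        have h2 := (hmono g).monotone h1
        rwa [hcancel] at h2
      · exact csInf_le hb (hinvX g hg _ hm)
    have hsub : X ⊆ {sInf X} := by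
      have h1 : orbitSet Γ (sInf X) ⊆ {sInf X} := by
        rintro y ⟨g, hg, rfl⟩
        exact hfix g hg
      exact (hdense _ hm).trans (closure_minimal h1 isClosed_singleton)
    have h2 := hperfect _ hm
    rw [Set.diff_eq_empty.mpr hsub, closure_empty] at h2
    exact h2
  have main : ∀ x : ℝ, X ⊆ closure (orbitSet Γ x) := by
    intro x p hp
    have hSne : (X ∩ Set.Iic x).Nonempty := by
      by_contra hcon
      apply hbdd
      refine ⟨x, fun y hy => ?_⟩
      by_contra hlt
      exact hcon ⟨y, hy, (not_le.mp hlt).le⟩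
    have hSb : BddAbove (X ∩ Set.Iic x) := ⟨x, fun y hy => hy.2⟩
    have haS : sSup (X ∩ Set.Iic x) ∈ X ∩ Set.Iic x :=
      (hcl.inter isClosed_Iic).csSup_mem hSne hSb
    obtain ⟨a, ha⟩ : ∃ a, a = sSup (X ∩ Set.Iic x) := ⟨_, rfl⟩
    rw [← ha] at haS
    have hgap : ∀ y ∈ X, y ≤ x → y ≤ a := by
      intro y hy hyx
      rw [ha]
      exact le_csSup hSb ⟨hy, hyx⟩
    rw [Metric.mem_closure_iff]
    intro ε hε
    have huv : ∃ u ∈ X, ∃ v ∈ X, p - ε < u ∧ u < v ∧ v < p + ε := by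
      obtain ⟨q, ⟨hq, hqp⟩, hd⟩ := Metric.mem_closure_iff.mp (hperfect p hp) ε hε
      rw [Real.dist_eq, abs_lt] at hd
      rcases lt_or_gt_of_ne (show q ≠ p from hqp) with h | h
      · exact ⟨q, hq, p, hp, by linarith, h, by linarith⟩
      · exact ⟨p, hp, q, hq, by linarith, h, by linarith⟩
    obtain ⟨u, hu, v, hv, h1, h2, h3⟩ := huv
    obtain ⟨_, ⟨hz1, hz2⟩, ⟨g, hg, rfl⟩⟩ :=
      mem_closure_iff.mp (hdense a haS.1 hu) (Set.Ioo (p - ε) v) isOpen_Ioo ⟨h1, h2⟩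
    refine ⟨(g : Equiv.Perm ℝ) x, ⟨g, hg, rfl⟩, ?_⟩
    have h4 := (hmono g).monotone haS.2
    have h5 : (g : Equiv.Perm ℝ) x < v := by
      by_contra hcon
      rw [not_lt] at hcon
      have h6 := hcancel g v
      have h7 : ((g⁻¹ : ↥HomeoPlusR) : Equiv.Perm ℝ) v ≤ x := by
        rw [← (hmono g).le_iff_le, h6]
        exact hcon
      have h8 := (hmono g).monotone (hgap _ (hinvX _ (Γ.inv_mem hg) v hv) h7)
      rw [h6] at h8
      linarith
    rw [Real.dist_eq, abs_lt]
    constructor <;> linarith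
  refine ⟨main, ?_⟩
  rintro Y ⟨y, hy⟩ hYc hYi
  refine (main y).trans (closure_minimal ?_ hYc)
  rintro _ ⟨g, hg, rfl⟩
  rw [← hYi g hg]
  exact ⟨y, hy, rfl⟩

end
end
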